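/- For every natural number n ≥ 1, the basepoint inclusion i_n : Sym^n(S^1) → Sym^{n+1}(S^1), sending the class of (z_1, …, z_n) to the class of (z_1, …, z_n, 1) (adding the basepoint 1 ∈ S^1), is a homotopy equivalence. -/

import Mathlib

/-- The setoid on `Fin n → X` identifying tuples that differ by a permutation
of the coordinates (the permutation action of the symmetric group `Σ_n`). -/
def permSetoid (n : ℕ) (X : Type*) : Setoid (Fin n → X) where
  r f g := ∃ σ : Equiv.Perm (Fin n), f ∘ σ = g
  iseqv := by
    refine ⟨fun f => ⟨Equiv.refl _, rfl⟩, ?_, ?_⟩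
    · rintro f g ⟨σ, rfl⟩
      exact ⟨σ.symm, by ext i; simp⟩
    · rintro f g h ⟨σ, rfl⟩ ⟨τ, rfl⟩
      exact ⟨τ.trans σ, rfl⟩

/-- The `n`-th symmetric product of `X`: the quotient of `X^n` by the
permutation action of the symmetric group `Σ_n`, with the quotient topology. -/
def SymProd (n : ℕ) (X : Type*) : Type _ := Quotient (permSetoid n X)

instance (n : ℕ) (X : Type*) [TopologicalSpace X] : TopologicalSpace (SymProd n X) :=
  inferInstanceAs (TopologicalSpace (Quotient (permSetoid n X)))

/-- The class of a tuple in the symmetric product. -/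
def SymProd.mk {n : ℕ} {X : Type*} (f : Fin n → X) : SymProd n X :=
  Quotient.mk (permSetoid n X) f

open Real

theorem SymProd.mk_comp_perm {n : ℕ} {X : Type*} (f : Fin n → X) (σ : Equiv.Perm (Fin n)) :
    SymProd.mk (f ∘ σ) = SymProd.mk f :=
  (Quotient.sound ⟨σ, rfl⟩ : SymProd.mk f = SymProd.mk (f ∘ σ)).symm

theorem SymProd.mk_eq_mk_iff {n : ℕ} {X : Type*} {f g : Fin n → X} :
    SymProd.mk f = SymProd.mk g ↔ ∃ σ : Equiv.Perm (Fin n), f ∘ σ = g :=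
  Quotient.eq (r := permSetoid n X)

theorem SymProd.mk_surjective {n : ℕ} {X : Type*} :
    Function.Surjective (SymProd.mk : (Fin n → X) → SymProd n X) :=
  Quotient.mk_surjective

theorem SymProd.continuous_mk {n : ℕ} {X : Type*} [TopologicalSpace X] :
    Continuous (SymProd.mk : (Fin n → X) → SymProd n X) :=
  continuous_quotient_mk'

theorem SymProd.isOpenQuotientMap_mk {n : ℕ} {X : Type*} [TopologicalSpace X] :
    IsOpenQuotientMap (SymProd.mk : (Fin n → X) → SymProd n X) where
  surjective := SymProd.mk_surjective
  continuous := SymProd.continuous_mk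
  isOpenMap U hU := by
    have hpre : SymProd.mk ⁻¹' (SymProd.mk '' U) =
        ⋃ σ : Equiv.Perm (Fin n), (fun f : Fin n → X => f ∘ σ) ⁻¹' U := by
      ext f
      simp only [Set.mem_preimage, Set.mem_image, Set.mem_iUnion]
      constructor
      · rintro ⟨g, hg, hgf⟩
        obtain ⟨σ, rfl⟩ := SymProd.mk_eq_mk_iff.1 hgf.symm
        exact ⟨σ, hg⟩
      · rintro ⟨σ, hσ⟩
        exact ⟨_, hσ, SymProd.mk_comp_perm f σ⟩
    have hquot : Topology.IsQuotientMap (SymProd.mk : (Fin n → X) → SymProd n X) :=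
      isQuotientMap_quotient_mk'
    rw [← hquot.isOpen_preimage, hpre]
    exact isOpen_iUnion fun σ => hU.preimage (by fun_prop)

instance SymProd.t2Space {n : ℕ} {X : Type*} [TopologicalSpace X] [T2Space X] :
    T2Space (SymProd n X) := by
  rw [t2Space_iff_of_isOpenQuotientMap (SymProd.isOpenQuotientMap_mk (n := n) (X := X))]
  simp only [SymProd.mk_eq_mk_iff, Set.ofPred_exists]
  exact isClosed_iUnion_of_finite fun σ => isClosed_eq (by fun_prop) (by fun_prop)

/-- The product of the entries of an unordered tuple of points of the circle. -/
noncomputable def circleProd (n : ℕ) : C(SymProd n Circle, Circle) where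
  toFun := Quotient.lift (fun f : Fin n → Circle => ∏ i, f i) (by
    rintro f _ ⟨σ, rfl⟩
    exact (Equiv.prod_comp σ f).symm)
  continuous_toFun := Continuous.quotient_lift (by fun_prop) _

theorem circleProd_mk {n : ℕ} (f : Fin n → Circle) : circleProd n (SymProd.mk f) = ∏ i, f i :=
  rfl

/-- The section of `circleProd` sending `z` to the class of `(z, 1, …, 1)`. -/
noncomputable def circleSection (m : ℕ) : C(Circle, SymProd (m + 1) Circle) where
  toFun z := SymProd.mk (Fin.cons z 1)
  continuous_toFun := SymProd.continuous_mk.comp (by fun_prop)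

theorem circleProd_circleSection {m : ℕ} (z : Circle) :
    circleProd (m + 1) (circleSection m z) = z := by
  simp [circleSection, circleProd_mk, Fin.prod_univ_succ]

/-- Adding a basepoint to an unordered tuple. -/
def SymProd.snoc {n : ℕ} {X : Type*} [TopologicalSpace X] (a : X) :
    C(SymProd n X, SymProd (n + 1) X) where
  toFun := Quotient.lift (fun f : Fin n → X => SymProd.mk (Fin.snoc f a : Fin (n + 1) → X)) (by
    rintro f _ ⟨σ, rfl⟩
    refine SymProd.mk_eq_mk_iff.2 ⟨finSuccEquivLast.permCongr.symm (Equiv.optionCongr σ), ?_⟩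
    ext i
    refine Fin.lastCases ?_ (fun j => ?_) i <;> simp)
  continuous_toFun := Continuous.quotient_lift (SymProd.continuous_mk.comp (by fun_prop)) _

theorem SymProd.snoc_mk {n : ℕ} {X : Type*} [TopologicalSpace X] (a : X) (f : Fin n → X) :
    SymProd.snoc a (SymProd.mk f) = SymProd.mk (Fin.snoc f a : Fin (n + 1) → X) :=
  rfl

theorem snoc_circleSection {m : ℕ} (z : Circle) :
    SymProd.snoc 1 (circleSection m z) = circleSection (m + 1) z := by
  change SymProd.mk _ = SymProd.mk _
  congr 1
  ext i
  refine Fin.lastCases ?_ (fun j => ?_) i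
  · rw [Fin.snoc_last, ← Fin.succ_last, Fin.cons_succ]
    rfl
  · rw [Fin.snoc_castSucc]
    refine Fin.cases ?_ (fun k => ?_) j
    · rfl
    · rw [Fin.castSucc_succ, Fin.cons_succ, Fin.cons_succ]
      rfl

theorem circleProd_snoc {n : ℕ} (x : SymProd n Circle) :
    circleProd (n + 1) (SymProd.snoc 1 x) = circleProd n x := by
  obtain ⟨f, rfl⟩ := SymProd.mk_surjective x
  simp [SymProd.snoc_mk, circleProd_mk, Fin.prod_univ_castSucc]

/-- The unordered tuple of points of the circle with given angles. -/
noncomputable def angleClass {n : ℕ} (x : Fin n → ℝ) : SymProd n Circle :=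
  SymProd.mk fun i => Circle.exp (x i)

theorem continuous_angleClass {n : ℕ} : Continuous (angleClass : (Fin n → ℝ) → _) :=
  SymProd.continuous_mk.comp (by fun_prop)

theorem circleProd_angleClass {n : ℕ} (x : Fin n → ℝ) :
    circleProd n (angleClass x) = Circle.exp (∑ i, x i) := by
  rw [angleClass, circleProd_mk]
  exact (map_sum Circle.expHom x Finset.univ).symm

/-- Cyclic rotation of a tuple of angles, the first angle being advanced by a full turn. -/
noncomputable def cyclicShift {m : ℕ} (x : Fin (m + 1) → ℝ) : Fin (m + 1) → ℝ :=
  Fin.snoc (fun i : Fin m => x i.succ) (x 0 + 2 * π)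

theorem cyclicShift_castSucc {m : ℕ} (x : Fin (m + 1) → ℝ) (i : Fin m) :
    cyclicShift x i.castSucc = x i.succ := by
  simp [cyclicShift]

theorem cyclicShift_last {m : ℕ} (x : Fin (m + 1) → ℝ) :
    cyclicShift x (Fin.last m) = x 0 + 2 * π := by
  simp [cyclicShift]

theorem angleClass_cyclicShift {m : ℕ} (x : Fin (m + 1) → ℝ) :
    angleClass (cyclicShift x) = angleClass x := by
  refine (SymProd.mk_eq_mk_iff.2 ⟨finRotate (m + 1), ?_⟩).symm
  funext i
  refine Fin.lastCases ?_ (fun j => ?_) i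
  · simp [cyclicShift_last]
  · simp [cyclicShift_castSucc]

theorem sum_cyclicShift {m : ℕ} (x : Fin (m + 1) → ℝ) :
    ∑ i, cyclicShift x i = ∑ i, x i + 2 * π := by
  rw [Fin.sum_univ_castSucc, Fin.sum_univ_succ x, cyclicShift_last]
  simp only [cyclicShift_castSucc]
  ring

/-- The evenly spaced tuple of angles determined by a total angle `s`. -/
noncomputable def evenAngles (m : ℕ) (s : ℝ) (i : Fin (m + 1)) : ℝ :=
  (s + 2 * π * i) / (m + 1)

theorem cyclicShift_evenAngles {m : ℕ} (s : ℝ) :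
    cyclicShift (evenAngles m s) = evenAngles m (s + 2 * π) := by
  funext i
  refine Fin.lastCases ?_ (fun j => ?_) i
  · rw [cyclicShift_last]
    simp only [evenAngles, Fin.val_zero, Fin.val_last]
    field_simp
    push_cast
    ring
  · rw [cyclicShift_castSucc]
    simp only [evenAngles, Fin.val_succ, Fin.val_castSucc]
    push_cast
    ring

theorem angleClass_evenAngles_congr {m : ℕ} {s u : ℝ} (h : Circle.exp s = Circle.exp u) :
    angleClass (evenAngles m s) = angleClass (evenAngles m u) := by
  have hper : Function.Periodic (fun s => angleClass (evenAngles m s)) (2 * π) := fun s => by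
    change angleClass _ = angleClass _
    rw [← cyclicShift_evenAngles, angleClass_cyclicShift]
  obtain ⟨k, rfl⟩ := Circle.exp_eq_exp.1 h
  exact hper.int_mul k u

/-- The linear homotopy from a tuple of angles to the evenly spaced one with the same total. -/
noncomputable def spread {m : ℕ} (t : ℝ) (x : Fin (m + 1) → ℝ) (i : Fin (m + 1)) : ℝ :=
  (1 - t) * x i + t * evenAngles m (∑ j, x j) i

theorem spread_zero {m : ℕ} (x : Fin (m + 1) → ℝ) : spread 0 x = x := by
  funext i
  simp [spread]

theorem spread_one {m : ℕ} (x : Fin (m + 1) → ℝ) : spread 1 x = evenAngles m (∑ j, x j) := by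
  funext i
  simp [spread]

theorem spread_cyclicShift {m : ℕ} (t : ℝ) (x : Fin (m + 1) → ℝ) :
    spread t (cyclicShift x) = cyclicShift (spread t x) := by
  funext i
  simp only [spread, sum_cyclicShift, ← cyclicShift_evenAngles]
  refine Fin.lastCases ?_ (fun j => ?_) i
  · simp only [cyclicShift_last, spread]
    ring
  · simp only [cyclicShift_castSucc, spread]

/-- Nondecreasing tuples of angles in `[-π, π]`. -/
def sortedAngles (n : ℕ) : Set (Fin n → ℝ) :=
  {x | Monotone x} ∩ Set.Icc (fun _ => -π) (fun _ => π)

instance {n : ℕ} : CompactSpace (sortedAngles n) :=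
  isCompact_iff_compactSpace.1 (isCompact_Icc.inter_left isClosed_monotone)

theorem exists_sortedAngles_angleClass_eq {n : ℕ} (y : SymProd n Circle) :
    ∃ x ∈ sortedAngles n, angleClass x = y := by
  obtain ⟨f, rfl⟩ := SymProd.mk_surjective y
  let a : Fin n → ℝ := fun i => Complex.arg (f i)
  refine ⟨a ∘ Tuple.sort a, ⟨Tuple.monotone_sort a, fun i => (Complex.neg_pi_lt_arg _).le,
    fun i => Complex.arg_le_pi _⟩, ?_⟩
  rw [← SymProd.mk_comp_perm f (Tuple.sort a)]
  simp only [angleClass]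
  congr 1
  funext i
  exact Circle.exp_arg _

theorem cyclicShift_mem_sortedAngles {m : ℕ} {x : Fin (m + 1) → ℝ}
    (hx : x ∈ sortedAngles (m + 1)) (h0 : x 0 = -π) : cyclicShift x ∈ sortedAngles (m + 1) := by
  obtain ⟨hmono, hl, hu⟩ := hx
  have hlast : cyclicShift x (Fin.last m) = π := by
    rw [cyclicShift_last, h0]
    ring
  refine ⟨?_, fun i => ?_, fun i => ?_⟩
  · intro i j hij
    induction j using Fin.lastCases with
    | last =>
      induction i using Fin.lastCases with
      | last => exact le_rfl
      | cast i => rw [hlast, cyclicShift_castSucc]; exact hu _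
    | cast j =>
      induction i using Fin.lastCases with
      | last => exact absurd hij (Fin.castSucc_lt_last j).not_ge
      | cast i =>
        rw [cyclicShift_castSucc, cyclicShift_castSucc]
        exact hmono (Fin.succ_le_succ_iff.2 (Fin.castSucc_le_castSucc_iff.1 hij))
  · induction i using Fin.lastCases with
    | last => rw [hlast]; linarith [pi_pos]
    | cast i => rw [cyclicShift_castSucc]; exact hl _
  · induction i using Fin.lastCases with
    | last => rw [hlast]
    | cast i => rw [cyclicShift_castSucc]; exact hu _

theorem exists_sortedAngles_gt_neg_pi {m : ℕ} (k : ℕ) {x : Fin (m + 1) → ℝ}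
    (hx : x ∈ sortedAngles (m + 1)) (hk : ∀ i : Fin (m + 1), k ≤ i → -π < x i) :
    ∃ y ∈ sortedAngles (m + 1), (∀ i, -π < y i) ∧
      ∀ t, angleClass (spread t y) = angleClass (spread t x) := by
  induction k generalizing x with
  | zero => exact ⟨x, hx, fun i => hk i (Nat.zero_le _), fun _ => rfl⟩
  | succ k ih =>
    by_cases h0 : x 0 = -π
    · obtain ⟨y, hy, hpos, hcl⟩ := ih (cyclicShift_mem_sortedAngles hx h0) (by
        intro i hi
        induction i using Fin.lastCases with
        | last =>
          rw [cyclicShift_last, h0]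
          linarith [pi_pos]
        | cast i =>
          rw [cyclicShift_castSucc]
          exact hk _ (by simpa using hi))
      refine ⟨y, hy, hpos, fun t => ?_⟩
      rw [hcl, spread_cyclicShift, angleClass_cyclicShift]
    · exact ⟨x, hx, fun i => (lt_of_le_of_ne (hx.2.1 0) (Ne.symm h0)).trans_le
        (hx.1 (Fin.zero_le i)), fun _ => rfl⟩

theorem angleClass_spread_congr {m : ℕ} {x x' : Fin (m + 1) → ℝ} (hx : x ∈ sortedAngles (m + 1))
    (hx' : x' ∈ sortedAngles (m + 1)) (h : angleClass x = angleClass x') (t : ℝ) :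
    angleClass (spread t x) = angleClass (spread t x') := by
  obtain ⟨y, hy, hpos, hcl⟩ := exists_sortedAngles_gt_neg_pi (m + 1) hx fun i hi => by omega
  obtain ⟨y', hy', hpos', hcl'⟩ := exists_sortedAngles_gt_neg_pi (m + 1) hx' fun i hi => by omega
  have hyy' : angleClass y = angleClass y' := by
    have h0 := hcl 0
    have h0' := hcl' 0
    simp only [spread_zero] at h0 h0'
    rw [h0, h0', h]
  obtain ⟨σ, hσ⟩ := SymProd.mk_eq_mk_iff.1 hyy'
  have hperm : y ∘ σ = y' := funext fun i => by
    have hi := congrArg (fun z : Circle => Complex.arg z) (congrFun hσ i)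
    simpa only [Function.comp_apply, Circle.arg_exp (hpos _) (hy.2.2 _),
      Circle.arg_exp (hpos' _) (hy'.2.2 _)] using hi
  have heq : y = y' := by
    rw [← hperm]
    exact Tuple.unique_monotone (f := y) (σ := 1) hy.1 (hperm ▸ hy'.1)
  rw [← hcl, ← hcl', heq]

/-- Parametrization of the cylinder on the symmetric product by sorted tuples of angles. -/
noncomputable def angleCylinder (n : ℕ) :
    C(unitInterval × sortedAngles n, unitInterval × SymProd n Circle) where
  toFun p := (p.1, angleClass p.2.1)
  continuous_toFun := continuous_fst.prodMk (continuous_angleClass.comp (by fun_prop))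

theorem isQuotientMap_angleCylinder (n : ℕ) : Topology.IsQuotientMap (angleCylinder n) := by
  refine (angleCylinder n).continuous.isClosedMap.isQuotientMap (angleCylinder n).continuous ?_
  rintro ⟨t, y⟩
  obtain ⟨x, hx, rfl⟩ := exists_sortedAngles_angleClass_eq y
  exact ⟨(t, ⟨x, hx⟩), rfl⟩

/-- The linear homotopy `spread` followed by passage to the symmetric product. -/
noncomputable def spreadClass (m : ℕ) :
    C(unitInterval × sortedAngles (m + 1), SymProd (m + 1) Circle) where
  toFun p := angleClass (spread (p.1 : ℝ) p.2.1)
  continuous_toFun := continuous_angleClass.comp (by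
    refine continuous_pi fun i => ?_
    have hc : ∀ j, Continuous fun p : unitInterval × sortedAngles (m + 1) => p.2.1 j :=
      fun j => (continuous_apply j).comp (continuous_subtype_val.comp continuous_snd)
    unfold spread evenAngles
    fun_prop)

theorem spreadClass_congr {m : ℕ} (p q : unitInterval × sortedAngles (m + 1))
    (h : angleCylinder (m + 1) p = angleCylinder (m + 1) q) :
    spreadClass m p = spreadClass m q := by
  obtain ⟨t, x⟩ := p
  obtain ⟨t', x'⟩ := q
  obtain ⟨rfl, h⟩ := Prod.mk.inj h
  exact angleClass_spread_congr x.2 x'.2 h t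

/-- The deformation of the symmetric product onto the evenly spaced configurations. -/
noncomputable def spreadHomotopy (m : ℕ) :
    C(unitInterval × SymProd (m + 1) Circle, SymProd (m + 1) Circle) :=
  (isQuotientMap_angleCylinder (m + 1)).lift (spreadClass m) spreadClass_congr

theorem spreadHomotopy_angleClass {m : ℕ} (t : unitInterval) {x : Fin (m + 1) → ℝ}
    (hx : x ∈ sortedAngles (m + 1)) :
    spreadHomotopy m (t, angleClass x) = angleClass (spread (t : ℝ) x) := by
  let p : unitInterval × sortedAngles (m + 1) := (t, ⟨x, hx⟩)
  have hlift : (spreadHomotopy m).comp (angleCylinder (m + 1)) = spreadClass m :=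
    (isQuotientMap_angleCylinder (m + 1)).lift_comp (spreadClass m) spreadClass_congr
  have h : spreadHomotopy m (angleCylinder (m + 1) p) = spreadClass m p := by
    rw [← hlift, ContinuousMap.comp_apply]
  exact h

theorem spreadHomotopy_zero {m : ℕ} (y : SymProd (m + 1) Circle) :
    spreadHomotopy m (0, y) = y := by
  obtain ⟨x, hx, rfl⟩ := exists_sortedAngles_angleClass_eq y
  rw [spreadHomotopy_angleClass 0 hx, Set.Icc.coe_zero, spread_zero]

theorem spreadHomotopy_one_congr {m : ℕ} {y y' : SymProd (m + 1) Circle}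
    (h : circleProd (m + 1) y = circleProd (m + 1) y') :
    spreadHomotopy m (1, y) = spreadHomotopy m (1, y') := by
  obtain ⟨x, hx, rfl⟩ := exists_sortedAngles_angleClass_eq y
  obtain ⟨x', hx', rfl⟩ := exists_sortedAngles_angleClass_eq y'
  rw [circleProd_angleClass, circleProd_angleClass] at h
  rw [spreadHomotopy_angleClass 1 hx, spreadHomotopy_angleClass 1 hx', Set.Icc.coe_one,
    spread_one, spread_one, angleClass_evenAngles_congr h]

theorem circleSection_comp_circleProd_homotopic_id (m : ℕ) :
    ((circleSection m).comp (circleProd (m + 1))).Homotopic (ContinuousMap.id _) := by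
  let e : C(SymProd (m + 1) Circle, SymProd (m + 1) Circle) :=
    ⟨fun y => spreadHomotopy m (1, y), by fun_prop⟩
  have he : (ContinuousMap.id _).Homotopic e :=
    ⟨⟨spreadHomotopy m, spreadHomotopy_zero, fun _ => rfl⟩⟩
  have hcomp : e.comp ((circleSection m).comp (circleProd (m + 1))) = e :=
    ContinuousMap.ext fun y => spreadHomotopy_one_congr (circleProd_circleSection _)
  have h := he.comp (ContinuousMap.Homotopic.refl ((circleSection m).comp (circleProd (m + 1))))
  rw [hcomp, ContinuousMap.id_comp] at h
  exact h.trans he.symm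

/-- For `n ≥ 1`, the basepoint inclusion `Sym^n(S^1) → Sym^{n+1}(S^1)`, sending
the class of `(z_1, …, z_n)` to the class of `(z_1, …, z_n, 1)`, is a homotopy
equivalence. -/
theorem symProd_circle_basepoint_inclusion_homotopyEquiv (n : ℕ) (hn : 1 ≤ n) :
    ∃ h : ContinuousMap.HomotopyEquiv (SymProd n Circle) (SymProd (n + 1) Circle),
      ∀ f : Fin n → Circle,
        h.toFun (SymProd.mk f) = SymProd.mk (Fin.snoc f (1 : Circle)) := by
  obtain ⟨m, rfl⟩ := Nat.exists_eq_add_of_le' hn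
  refine ⟨⟨SymProd.snoc 1, (circleSection m).comp (circleProd (m + 1 + 1)), ?_, ?_⟩,
    SymProd.snoc_mk 1⟩
  · convert circleSection_comp_circleProd_homotopic_id m using 1
    exact ContinuousMap.ext fun x => congrArg (circleSection m) (circleProd_snoc x)
  · convert circleSection_comp_circleProd_homotopic_id (m + 1) using 1
    exact ContinuousMap.ext fun x => snoc_circleSection _
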